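/- arXiv:0705.1235 — 7 statements merged into one kernel-verified Lean document; each statement's English description precedes it below -/
import Mathlib

section
/- For every integer n ≥ 1, σ_n² ≥ 4^{n−1}, where σ_n² = ((2n+1)/2) · 4^{−n} · Σ_{j=0}^{⌊n/2⌋} (C(n,j) · C(2n−2j, n))². -/
open Finset

/-- `σ_k²`, the sum of the squared coefficients of the normalized Legendre polynomial of
degree `k`: `σ_k² = ((2k+1)/2) · 4^(−k) · Σ_{j=0}^{⌊k/2⌋} (C(k,j) · C(2k−2j, k))²`. -/
noncomputable def sigmaSq (k : ℕ) : ℝ :=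
  ((2 * k + 1 : ℝ) / 2) / 4 ^ k *
    ∑ j ∈ Finset.range (k / 2 + 1),
      ((k.choose j : ℝ) * ((2 * k - 2 * j).choose k : ℝ)) ^ 2

open Polynomial in
/-- The sum of the unsigned Legendre coefficients is the central coefficient of
`((1 + X)² + 1)ⁿ`. -/
lemma sum_choose_mul_choose_eq_coeff (n : ℕ) :
    ∑ j ∈ Finset.range (n / 2 + 1), (n.choose j : ℝ) * ((2 * n - 2 * j).choose n : ℝ) =
      ((1 + (1 + X : ℝ[X]) ^ 2) ^ n).coeff n := by
  rw [add_pow, finsetSum_coeff]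
  refine (Finset.sum_subset (Finset.range_mono (by omega)) fun j hjn hj => ?_).trans
    (Finset.sum_congr rfl fun j _ => ?_)
  · rw [Finset.mem_range] at hj hjn
    rw [Nat.choose_eq_zero_of_lt (show 2 * n - 2 * j < n by omega)]
    simp
  · rw [one_pow, one_mul, ← pow_mul, coeff_mul_natCast, coeff_one_add_X_pow, Nat.mul_sub,
      mul_comm]

lemma two_pow_le_centralBinom (n : ℕ) : 2 ^ n ≤ n.centralBinom := by
  induction n with
  | zero => simp
  | succ n ih =>
    have h := Nat.succ_mul_centralBinom_succ n
    refine Nat.le_of_mul_le_mul_left ?_ n.succ_pos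
    calc (n + 1) * 2 ^ (n + 1) = 2 * (n + 1) * 2 ^ n := by ring
      _ ≤ 2 * (2 * n + 1) * n.centralBinom := by gcongr; omega
      _ = (n + 1) * (n + 1).centralBinom := h.symm

open Polynomial in
lemma two_pow_add_neg_two_pow_le_coeff (m : ℕ) :
    (2 : ℝ) ^ m + (-2) ^ m ≤ 2 * ((X ^ 2 + C 2 : ℝ[X]) ^ m).coeff m := by
  have hexpand : (X ^ 2 + C 2 : ℝ[X]) ^ m = expand ℝ 2 ((X + C 2) ^ m) := by simp
  rw [hexpand, coeff_expand two_pos]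
  rcases m.even_or_odd' with ⟨k, rfl | rfl⟩
  · have hk : (2 : ℝ) ^ k ≤ ((2 * k).choose k : ℝ) := by
      exact_mod_cast two_pow_le_centralBinom k
    rw [if_pos (dvd_mul_right 2 k), Nat.mul_div_cancel_left k two_pos, coeff_X_add_C_pow,
      pow_mul (-2 : ℝ), neg_sq, ← pow_mul, two_mul k, Nat.add_sub_cancel, pow_add, ← two_mul k]
    nlinarith [mul_le_mul_of_nonneg_left hk (pow_nonneg (zero_le_two (α := ℝ)) k)]
  · rw [if_neg (by omega), Odd.neg_pow (odd_two_mul_add_one k)]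
    simp

open Polynomial in
lemma four_pow_le_two_mul_coeff (n : ℕ) (hn : n ≠ 0) :
    (4 : ℝ) ^ n ≤ 2 * ((1 + (1 + X : ℝ[X]) ^ 2) ^ n).coeff n := by
  have hsplit : (1 + (1 + X : ℝ[X]) ^ 2) = (X ^ 2 + C 2) + C 2 * X := by
    rw [C_ofNat]; ring
  rw [hsplit, add_pow, finsetSum_coeff, Finset.mul_sum]
  calc (4 : ℝ) ^ n = (2 + 2) ^ n + (-2 + 2) ^ n := by norm_num [hn]
    _ = ∑ m ∈ Finset.range (n + 1), (2 ^ m + (-2) ^ m) * (2 ^ (n - m) * (n.choose m : ℝ)) := by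
      rw [add_pow, add_pow, ← Finset.sum_add_distrib]
      exact Finset.sum_congr rfl fun m _ => by ring
    _ ≤ _ := Finset.sum_le_sum fun m hm => ?_
  have hcoeff : ((X ^ 2 + C 2 : ℝ[X]) ^ m * (C 2 * X) ^ (n - m) * (n.choose m : ℝ[X])).coeff n =
      ((X ^ 2 + C 2 : ℝ[X]) ^ m).coeff m * (2 ^ (n - m) * (n.choose m : ℝ)) := by
    have hmn := Finset.mem_range.mp hm
    rw [coeff_mul_natCast, mul_pow, ← C_pow, ← mul_assoc, coeff_mul_X_pow', if_pos (by omega),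
      coeff_mul_C, show n - (n - m) = m by omega, mul_assoc]
  rw [hcoeff, ← mul_assoc 2]
  exact mul_le_mul_of_nonneg_right (two_pow_add_neg_two_pow_le_coeff m) (by positivity)

/-- For every integer `n ≥ 1`, `σ_n² ≥ 4^(n−1)`. -/
theorem sigmaSq_ge_pow (n : ℕ) (hn : 1 ≤ n) :
    (4 : ℝ) ^ (n - 1) ≤ sigmaSq n := by
  have hsum := four_pow_le_two_mul_coeff n (by omega)
  rw [← sum_choose_mul_choose_eq_coeff] at hsum
  have hcs := sq_sum_le_card_mul_sum_sq (s := Finset.range (n / 2 + 1))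
    (f := fun j => (n.choose j : ℝ) * ((2 * n - 2 * j).choose n : ℝ))
  rw [Finset.card_range] at hcs
  unfold sigmaSq
  set A := ∑ j ∈ Finset.range (n / 2 + 1), (n.choose j : ℝ) * ((2 * n - 2 * j).choose n : ℝ)
  set S := ∑ j ∈ Finset.range (n / 2 + 1),
    ((n.choose j : ℝ) * ((2 * n - 2 * j).choose n : ℝ)) ^ 2
  have hS : 0 ≤ S := Finset.sum_nonneg fun _ _ => sq_nonneg _
  have hcard : (2 : ℝ) * ((n / 2 + 1 : ℕ) : ℝ) ≤ 2 * n + 1 := by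
    exact_mod_cast (by omega : 2 * (n / 2 + 1) ≤ 2 * n + 1)
  have hsq : ((4 : ℝ) ^ n) ^ 2 ≤ (2 * A) ^ 2 := pow_le_pow_left₀ (by positivity) hsum 2
  have hpow : (4 : ℝ) ^ n = 4 * 4 ^ (n - 1) := by
    rw [← pow_succ', Nat.sub_add_cancel hn]
  rw [div_mul_eq_mul_div, le_div_iff₀ (by positivity)]
  have hsq' : (4 : ℝ) ^ (n - 1) * 4 ^ n = (4 ^ n) ^ 2 / 4 := by rw [hpow]; ring
  nlinarith [mul_le_mul_of_nonneg_right hcard hS]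
end

section
/- For every integer n ≥ 1, σ_n² ≥ (n / 4^n) · C(2n, n)², where σ_n² = ((2n+1)/2) · 4^{−n} · Σ_{j=0}^{⌊n/2⌋} (C(n,j) · C(2n−2j, n))². -/
open Finset

/-- For every integer `n ≥ 1`, `σ_n² ≥ (n / 4^n) · C(2n, n)²`. -/
theorem sigmaSq_ge_centralBinom (n : ℕ) (hn : 1 ≤ n) :
    (n : ℝ) / 4 ^ n * ((2 * n).choose n : ℝ) ^ 2 ≤ sigmaSq n := by
  have first_term_le : ((2 * n).choose n : ℝ) ^ 2 ≤ ∑ j ∈ Finset.range (n / 2 + 1),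
      ((n.choose j : ℝ) * ((2 * n - 2 * j).choose n : ℝ)) ^ 2 := by
    simpa using Finset.single_le_sum
      (f := fun j ↦ ((n.choose j : ℝ) * ((2 * n - 2 * j).choose n : ℝ)) ^ 2)
      (fun j _ ↦ sq_nonneg _) (Finset.mem_range.2 (Nat.succ_pos (n / 2)))
  unfold sigmaSq
  gcongr
  linarith
end

section
/- For every integer k ≥ 1, σ_k² ≤ ((2k+1)/2) · 4^{2k} / √k, where σ_k² = ((2k+1)/2) · 4^{−k} · Σ_{j=0}^{⌊k/2⌋} (C(k,j) · C(2k−2j, k))². -/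
open Finset

/-- The bound `C(2k, k) ≤ 4^k / √(2k+1)`, in squared form. -/
lemma Nat.two_mul_add_one_mul_centralBinom_sq_le (k : ℕ) :
    (2 * k + 1) * k.centralBinom ^ 2 ≤ 16 ^ k := by
  induction k with
  | zero => simp
  | succ k ih =>
    have h := Nat.succ_mul_centralBinom_succ k
    refine Nat.le_of_mul_le_mul_left ?_ (show 0 < (k + 1) ^ 2 by positivity)
    calc (k + 1) ^ 2 * ((2 * (k + 1) + 1) * (k + 1).centralBinom ^ 2)
        = (2 * k + 3) * ((k + 1) * (k + 1).centralBinom) ^ 2 := by ring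
      _ = 4 * ((2 * k + 1) * (2 * k + 3)) * ((2 * k + 1) * k.centralBinom ^ 2) := by
        rw [h]; ring
      _ ≤ 4 * (4 * (k + 1) ^ 2) * 16 ^ k := by
        have hodd : (2 * k + 1) * (2 * k + 3) ≤ 4 * (k + 1) ^ 2 := by nlinarith
        exact Nat.mul_le_mul (Nat.mul_le_mul_left 4 hodd) ih
      _ = (k + 1) ^ 2 * 16 ^ (k + 1) := by ring

/-- The sum of the squares of `C(k,j) · C(2k−2j, k)` is at most `C(2k, k)^3`. -/
lemma Nat.sum_choose_mul_choose_sq_le (k : ℕ) :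
    ∑ j ∈ Finset.range (k / 2 + 1), (k.choose j * (2 * k - 2 * j).choose k) ^ 2
      ≤ k.centralBinom ^ 3 := by
  calc ∑ j ∈ Finset.range (k / 2 + 1), (k.choose j * (2 * k - 2 * j).choose k) ^ 2
      ≤ ∑ j ∈ Finset.range (k / 2 + 1), k.choose j ^ 2 * k.centralBinom ^ 2 := by
        refine Finset.sum_le_sum fun j _ => ?_
        rw [mul_pow, Nat.centralBinom_eq_two_mul_choose]
        gcongr
        exact Nat.sub_le _ _
    _ ≤ ∑ j ∈ Finset.range (k + 1), k.choose j ^ 2 * k.centralBinom ^ 2 :=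
        Finset.sum_le_sum_of_subset (Finset.range_mono (by omega))
    _ = k.centralBinom ^ 3 := by
        rw [← Finset.sum_mul, Nat.sum_range_choose_sq, ← Nat.centralBinom_eq_two_mul_choose]
        ring

/-- For every integer `k ≥ 1`, `σ_k² ≤ ((2k+1)/2) · 4^(2k) / √k`. -/
theorem sigmaSq_le (k : ℕ) (hk : 1 ≤ k) :
    sigmaSq k ≤ ((2 * k + 1 : ℝ) / 2) * 4 ^ (2 * k) / Real.sqrt k := by
  have hk0 : (0 : ℝ) < k := by exact_mod_cast hk
  have hsum : ∑ j ∈ Finset.range (k / 2 + 1),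
      ((k.choose j : ℝ) * ((2 * k - 2 * j).choose k : ℝ)) ^ 2 ≤ (k.centralBinom : ℝ) ^ 3 := by
    exact_mod_cast Nat.sum_choose_mul_choose_sq_le k
  have hsq : (2 * k + 1 : ℝ) * (k.centralBinom : ℝ) ^ 2 ≤ 16 ^ k := by
    exact_mod_cast Nat.two_mul_add_one_mul_centralBinom_sq_le k
  have h16 : (16 : ℝ) ^ k = (4 ^ k) ^ 2 := by rw [← pow_mul, mul_comm, pow_mul]; norm_num
  have hc : (k.centralBinom : ℝ) ≤ 4 ^ k := by
    refine (abs_le_of_sq_le_sq' ?_ (by positivity)).2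
    nlinarith [sq_nonneg (k.centralBinom : ℝ)]
  have hsqrt : (k.centralBinom : ℝ) * Real.sqrt k ≤ 4 ^ k := by
    refine (abs_le_of_sq_le_sq' ?_ (by positivity)).2
    rw [mul_pow, Real.sq_sqrt hk0.le]
    nlinarith [sq_nonneg (k.centralBinom : ℝ)]
  rw [sigmaSq, le_div_iff₀ (Real.sqrt_pos.2 hk0)]
  calc (2 * k + 1 : ℝ) / 2 / 4 ^ k * (∑ j ∈ Finset.range (k / 2 + 1),
        ((k.choose j : ℝ) * ((2 * k - 2 * j).choose k : ℝ)) ^ 2) * Real.sqrt k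
      ≤ (2 * k + 1 : ℝ) / 2 / 4 ^ k * (k.centralBinom : ℝ) ^ 3 * Real.sqrt k := by gcongr
    _ = (2 * k + 1 : ℝ) / 2 / 4 ^ k *
        ((k.centralBinom : ℝ) ^ 2 * (k.centralBinom * Real.sqrt k)) := by ring
    _ ≤ (2 * k + 1 : ℝ) / 2 / 4 ^ k * ((4 ^ k) ^ 2 * 4 ^ k) := by gcongr
    _ = (2 * k + 1 : ℝ) / 2 * 4 ^ (2 * k) := by
      rw [mul_comm 2 k, pow_mul]
      field_simp
end

section
/- Let ε > 0 and let (σ_k)_{k∈ℕ} be a sequence of strictly positive reals. Let θ = (θ_k) and θ' = (θ'_k) be real sequences with Σ_k (θ_k − θ'_k)²/σ_k² < ∞. Let P_θ and P_{θ'} be the countable product probability measures on ℝ^ℕ whose k-th factors are the Gaussian measures N(θ_k, ε²σ_k²) and N(θ'_k, ε²σ_k²) respectively. Then the Kullback–Leibler divergence satisfies KL(P_θ, P_{θ'}) = (1/(2ε²)) · Σ_{k=0}^{∞} (θ_k − θ'_k)² / σ_k². -/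
open MeasureTheory ProbabilityTheory Classical

/-- The Kullback–Leibler divergence `KL(P, Q) = ∫ log(dP/dQ) dP` when `P ≪ Q` (and the
log-likelihood ratio is integrable), and `+∞` otherwise. -/
noncomputable def klDiv {Ω : Type*} [MeasurableSpace Ω] (P Q : Measure Ω) : EReal :=
  if P ≪ Q ∧ Integrable (llr P Q) P then ((∫ x, llr P Q x ∂P : ℝ) : EReal) else ⊤

open scoped NNReal ENNReal
open Filter Topology

/-- A sequence in a Hilbert space whose Gram matrix is `u (min m n)` converges as soon as `u`
does. -/
theorem exists_tendsto_of_inner_eq_of_le {E : Type*} [NormedAddCommGroup E]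
    [InnerProductSpace ℝ E] [CompleteSpace E] {F : ℕ → E} {u : ℕ → ℝ} {l : ℝ}
    (hF : ∀ m n, m ≤ n → inner ℝ (F m) (F n) = u m) (hu : Tendsto u atTop (𝓝 l)) :
    ∃ G, Tendsto F atTop (𝓝 G) := by
  have hdist : ∀ m n, m ≤ n → dist (F m) (F n) ^ 2 = u n - u m := by
    intro m n hmn
    rw [dist_eq_norm, norm_sub_sq_real, hF m n hmn, ← real_inner_self_eq_norm_sq,
      ← real_inner_self_eq_norm_sq, hF m m le_rfl, hF n n le_rfl]
    ring
  refine cauchySeq_tendsto_of_complete (Metric.cauchySeq_iff'.2 fun ε hε ↦ ?_)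
  obtain ⟨N, hN⟩ := Metric.cauchySeq_iff'.1 hu.cauchySeq (ε ^ 2) (by positivity)
  refine ⟨N, fun n hn ↦ ?_⟩
  rw [dist_comm]
  refine lt_of_pow_lt_pow_left₀ 2 hε.le ?_
  rw [hdist N n hn]
  exact (le_abs_self _).trans_lt (hN n hn)

/-- The integral of a finite product of functions of distinct coordinates factorizes. -/
theorem integral_infinitePi_prod {ι : Type*} {X : ι → Type*} [∀ i, MeasurableSpace (X i)]
    (μ : ∀ i, Measure (X i)) [∀ i, IsProbabilityMeasure (μ i)] (s : Finset ι)
    {f : ∀ i, X i → ℝ} (hf : ∀ i, Measurable (f i)) :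
    ∫ x, ∏ i ∈ s, f i (x i) ∂Measure.infinitePi μ = ∏ i ∈ s, ∫ y, f i y ∂μ i := by
  have h := integral_restrict_infinitePi (μ := μ) (s := s)
    (f := fun y ↦ ∏ i : s, f i (y i)) (Measurable.aestronglyMeasurable (by fun_prop))
  rw [integral_fintype_prod_eq_prod (fun (i : s) ↦ f i)] at h
  simpa only [Finset.restrict, Finset.prod_coe_sort s (fun i ↦ ∫ y, f i y ∂μ i),
    Finset.prod_coe_sort s (fun i ↦ f i _)] using h

/-- Shift `a * v` of the mean of a Gaussian, expressed by its log-likelihood ratio. -/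
theorem exp_mul_gaussianPDFReal (m a : ℝ) {v : ℝ≥0} (hv : v ≠ 0) (x : ℝ) :
    Real.exp (a * (x - m) - a ^ 2 * v / 2) * gaussianPDFReal m v x =
      gaussianPDFReal (m + a * v) v x := by
  have : (v : ℝ) ≠ 0 := by exact_mod_cast hv
  simp only [gaussianPDFReal]
  rw [mul_left_comm, ← Real.exp_add]
  congr 2
  field_simp
  ring

theorem setIntegral_exp_gaussianReal (m a : ℝ) {v : ℝ≥0} (hv : v ≠ 0) {t : Set ℝ}
    (ht : MeasurableSet t) :
    ∫ x, t.indicator 1 x * Real.exp (a * (x - m) - a ^ 2 * v / 2) ∂gaussianReal m v =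
      (gaussianReal (m + a * v) v).real t := by
  rw [integral_gaussianReal_eq_integral_smul hv, measureReal_def,
   gaussianReal_apply_eq_integral _ hv, ENNReal.toReal_ofReal
    (integral_nonneg fun x ↦ gaussianPDFReal_nonneg _ _ _), ← integral_indicator ht]
  congr with x
  by_cases hx : x ∈ t <;> simp [hx, ← exp_mul_gaussianPDFReal m a hv x, mul_comm]

theorem integral_exp_gaussianReal (m a : ℝ) {v : ℝ≥0} (hv : v ≠ 0) :
    ∫ x, Real.exp (a * (x - m) - a ^ 2 * v / 2) ∂gaussianReal m v = 1 := by
  simpa using setIntegral_exp_gaussianReal m a hv MeasurableSet.univ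

theorem integral_exp_sq_gaussianReal (m a : ℝ) {v : ℝ≥0} (hv : v ≠ 0) :
    ∫ x, Real.exp (a * (x - m) - a ^ 2 * v / 2) ^ 2 ∂gaussianReal m v = Real.exp (a ^ 2 * v) := by
  have h (x : ℝ) : Real.exp (a * (x - m) - a ^ 2 * v / 2) ^ 2 =
      Real.exp (a ^ 2 * v) * Real.exp ((2 * a) * (x - m) - (2 * a) ^ 2 * v / 2) := by
    rw [← Real.exp_nat_mul, ← Real.exp_add]
    congr 1
    push_cast
    ring
  simp_rw [h, integral_const_mul, integral_exp_gaussianReal m (2 * a) hv, mul_one]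

/-- Orthogonal increments with convergent second moments give convergence in `L²`. -/
theorem exists_memLp_two_of_integral_mul_eq {Ω : Type*} [MeasurableSpace Ω] {μ : Measure Ω}
    {f : ℕ → Ω → ℝ} (hf : ∀ n, MemLp (f n) 2 μ) {u : ℕ → ℝ} {l : ℝ}
    (hfu : ∀ m n, m ≤ n → ∫ x, f m x * f n x ∂μ = u m) (hu : Tendsto u atTop (𝓝 l)) :
    ∃ g : Ω → ℝ, Measurable g ∧ MemLp g 2 μ ∧ TendstoInMeasure μ f atTop g ∧
      ∀ h, MemLp h 2 μ → Tendsto (fun n ↦ ∫ x, f n x * h x ∂μ) atTop (𝓝 (∫ x, g x * h x ∂μ)) := by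
  have hinner {φ ψ : Ω → ℝ} (hφ : MemLp φ 2 μ) (hψ : MemLp ψ 2 μ) :
      inner ℝ (hφ.toLp φ) (hψ.toLp ψ) = ∫ x, φ x * ψ x ∂μ := by
    rw [L2.inner_def]
    refine integral_congr_ae ?_
    filter_upwards [hφ.coeFn_toLp, hψ.coeFn_toLp] with x hx hy
    simp [hx, hy, mul_comm]
  obtain ⟨G, hG⟩ := exists_tendsto_of_inner_eq_of_le (F := fun n ↦ (hf n).toLp (f n))
    (fun m n hmn ↦ (hinner (hf m) (hf n)).trans (hfu m n hmn)) hu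
  have hGm : MemLp G 2 μ := Lp.memLp G
  refine ⟨G, (Lp.stronglyMeasurable G).measurable, hGm, ?_, fun h hh ↦ ?_⟩
  · exact (tendstoInMeasure_of_tendsto_Lp hG).congr_left fun n ↦ (hf n).coeFn_toLp
  · have := hG.inner (𝕜 := ℝ) (tendsto_const_nhds (x := hh.toLp h))
    rw [← Lp.toLp_coeFn G hGm, hinner hGm hh] at this
    simpa only [hinner] using this

section GaussianSequence

variable (m a : ℕ → ℝ) (v : ℕ → ℝ≥0)

/-- The law of a sequence of independent Gaussian variables. -/
noncomputable def gaussianSeq : Measure (ℕ → ℝ) :=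
  Measure.infinitePi fun k ↦ gaussianReal (m k) (v k)

instance : IsProbabilityMeasure (gaussianSeq m v) := by
  unfold gaussianSeq
  infer_instance

/-- The centred linear part of the log-likelihood ratio of the first `n` coordinates. -/
noncomputable def gaussianScore (n : ℕ) (x : ℕ → ℝ) : ℝ :=
  ∑ k ∈ Finset.range n, a k * (x k - m k)

/-- Twice the Kullback-Leibler divergence carried by the first `n` coordinates. -/
noncomputable def gaussianInfo (n : ℕ) : ℝ := ∑ k ∈ Finset.range n, a k ^ 2 * v k

/-- The likelihood ratio of the first `n` coordinates. -/
noncomputable def gaussianLikelihood (n : ℕ) (x : ℕ → ℝ) : ℝ :=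
  Real.exp (gaussianScore m a n x - gaussianInfo a v n / 2)

theorem measurable_gaussianScore (n : ℕ) : Measurable (gaussianScore m a n) := by
  unfold gaussianScore
  fun_prop

theorem measurable_gaussianLikelihood (n : ℕ) : Measurable (gaussianLikelihood m a v n) :=
  (((measurable_gaussianScore m a n).sub_const _)).exp

theorem gaussianLikelihood_eq_prod (n : ℕ) (x : ℕ → ℝ) :
    gaussianLikelihood m a v n x =
      ∏ k ∈ Finset.range n, Real.exp (a k * (x k - m k) - a k ^ 2 * v k / 2) := by
  rw [← Real.exp_sum, Finset.sum_sub_distrib, ← Finset.sum_div]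
  rfl

variable {v}

theorem integral_gaussianLikelihood_mul (hv : ∀ k, v k ≠ 0) {i j : ℕ} (hij : i ≤ j) :
    ∫ x, gaussianLikelihood m a v i x * gaussianLikelihood m a v j x ∂gaussianSeq m v =
      Real.exp (gaussianInfo a v i) := by
  let e (k : ℕ) (y : ℝ) : ℝ := Real.exp (a k * (y - m k) - a k ^ 2 * v k / 2)
  have hprod (x : ℕ → ℝ) : gaussianLikelihood m a v i x * gaussianLikelihood m a v j x =
      ∏ k ∈ Finset.range j, (if k < i then e k (x k) ^ 2 else e k (x k)) := by
    rw [gaussianLikelihood_eq_prod, gaussianLikelihood_eq_prod,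
      ← Finset.prod_range_mul_prod_Ico _ hij, ← Finset.prod_range_mul_prod_Ico _ hij, ← mul_assoc,
      ← Finset.prod_mul_distrib]
    congr 1
    · exact Finset.prod_congr rfl fun k hk ↦ by simp [Finset.mem_range.1 hk, e, sq]
    · exact Finset.prod_congr rfl fun k hk ↦ by simp [(Finset.mem_Ico.1 hk).1.not_gt, e]
  simp_rw [hprod]
  rw [gaussianSeq, integral_infinitePi_prod _ _ (f := fun k y ↦ if k < i then e k y ^ 2 else e k y)
    (fun k ↦ by split_ifs <;> fun_prop), ← Finset.prod_range_mul_prod_Ico _ hij, gaussianInfo,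
    Real.exp_sum]
  rw [Finset.prod_eq_one (s := Finset.Ico i j), mul_one]
  · refine Finset.prod_congr rfl fun k hk ↦ ?_
    simpa [Finset.mem_range.1 hk] using integral_exp_sq_gaussianReal (m k) (a k) (hv k)
  · intro k hk
    simpa [(Finset.mem_Ico.1 hk).1.not_gt] using integral_exp_gaussianReal (m k) (a k) (hv k)

theorem memLp_gaussianLikelihood (hv : ∀ k, v k ≠ 0) (n : ℕ) :
    MemLp (gaussianLikelihood m a v n) 2 (gaussianSeq m v) := by
  rw [memLp_two_iff_integrable_sq (measurable_gaussianLikelihood m a v n).aestronglyMeasurable]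
  refine Integrable.of_integral_ne_zero ?_
  simp_rw [sq, integral_gaussianLikelihood_mul m a hv le_rfl]
  positivity

theorem setIntegral_gaussianLikelihood (hv : ∀ k, v k ≠ 0) {s : Finset ℕ} {t : ℕ → Set ℝ}
    (ht : ∀ k, MeasurableSet (t k)) {n : ℕ} (hn : s ⊆ Finset.range n) :
    ∫ x, gaussianLikelihood m a v n x * (Set.pi s t).indicator 1 x ∂gaussianSeq m v =
      ∏ k ∈ s, (gaussianReal (m k + a k * v k) (v k)).real (t k) := by
  let r (k : ℕ) : Set ℝ := if k ∈ s then t k else Set.univ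
  have hr (k : ℕ) : MeasurableSet (r k) := by
    simp only [r]
    split_ifs
    exacts [ht k, .univ]
  have hprod (x : ℕ → ℝ) : gaussianLikelihood m a v n x * (Set.pi s t).indicator 1 x =
      ∏ k ∈ Finset.range n,
        ((r k).indicator 1 (x k) * Real.exp (a k * (x k - m k) - a k ^ 2 * v k / 2)) := by
    rw [Finset.prod_mul_distrib, gaussianLikelihood_eq_prod, mul_comm]
    congr 1
    rw [← Finset.prod_subset hn fun k _ hk ↦ by simp [r, hk]]
    have : ∏ k ∈ s, (r k).indicator (1 : ℝ → ℝ) (x k) = ∏ k ∈ s, (t k).indicator 1 (x k) :=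
      Finset.prod_congr rfl fun k hk ↦ by simp [r, hk]
    rw [this]
    by_cases hx : x ∈ Set.pi s t
    · rw [Set.indicator_of_mem hx, Finset.prod_eq_one fun k hk ↦ by simp [hx k hk]]
      rfl
    · rw [Set.indicator_of_notMem hx]
      obtain ⟨k, hk, hkt⟩ : ∃ k ∈ s, x k ∉ t k := by simpa [Set.mem_pi] using hx
      exact (Finset.prod_eq_zero hk (by simp [hkt])).symm
  simp_rw [hprod]
  rw [gaussianSeq, integral_infinitePi_prod _ _
    (f := fun k y ↦ (r k).indicator 1 y * Real.exp (a k * (y - m k) - a k ^ 2 * v k / 2))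
    (fun k ↦ (measurable_one.indicator (hr k)).mul (by fun_prop))]
  simp_rw [fun k ↦ setIntegral_exp_gaussianReal (m k) (a k) (hv k) (hr k)]
  rw [← Finset.prod_subset hn fun k _ hk ↦ by simp [r, hk]]
  exact Finset.prod_congr rfl fun k hk ↦ by simp [r, hk]

variable (v)

theorem memLp_eval_sub (k : ℕ) (m' : ℝ) :
    MemLp (fun x : ℕ → ℝ ↦ x k - m') 2 (gaussianSeq m v) :=
  ((memLp_id_gaussianReal' 2 (by simp)).comp_measurePreserving
    (measurePreserving_eval_infinitePi (fun k ↦ gaussianReal (m k) (v k)) k)).sub (memLp_const m')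

theorem integral_eval_sub (k : ℕ) (m' : ℝ) :
    ∫ x, (x k - m') ∂gaussianSeq m v = m k - m' := by
  have h : ∫ x, x k ∂gaussianSeq m v = m k := by
    have := (measurePreserving_eval_infinitePi (fun k ↦ gaussianReal (m k) (v k)) k).map_eq
    rw [← integral_id_gaussianReal (μ := m k) (v := v k), ← this,
      integral_map (measurable_pi_apply k).aemeasurable (by fun_prop)]
    rfl
  rw [integral_sub _ (integrable_const m'), h]
  · simp
  · simpa using (memLp_eval_sub m v k 0).integrable (by simp)

theorem memLp_gaussianScore (m' : ℕ → ℝ) (n : ℕ) :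
    MemLp (gaussianScore m' a n) 2 (gaussianSeq m v) :=
  memLp_finsetSum _ fun k _ ↦ (memLp_eval_sub m v k (m' k)).const_mul (a k)

theorem integral_gaussianScore (m' : ℕ → ℝ) (n : ℕ) :
    ∫ x, gaussianScore m' a n x ∂gaussianSeq m v =
      ∑ k ∈ Finset.range n, a k * (m k - m' k) := by
  unfold gaussianScore
  rw [integral_finsetSum _ fun k _ ↦
    ((memLp_eval_sub m v k (m' k)).const_mul (a k)).integrable (by simp)]
  simp_rw [integral_const_mul, integral_eval_sub]

theorem integral_gaussianScore_mul {i j : ℕ} (hij : i ≤ j) :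
    ∫ x, gaussianScore m a i x * gaussianScore m a j x ∂gaussianSeq m v =
      gaussianInfo a v i := by
  let X (k : ℕ) (x : ℕ → ℝ) : ℝ := a k * (x k - m k)
  have hX (k : ℕ) : MemLp (X k) 2 (gaussianSeq m v) := (memLp_eval_sub m v k (m k)).const_mul (a k)
  have hS (n : ℕ) : gaussianScore m a n = ∑ k ∈ Finset.range n, X k := by
    ext x
    simp [gaussianScore, X]
  have hcov (k l : ℕ) : cov[X k, X l; gaussianSeq m v] = if k = l then a k ^ 2 * v k else 0 := by
    split_ifs with hkl
    · subst hkl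
      rw [covariance_self (hX k).aemeasurable, variance_const_mul]
      congr 1
      rw [variance_sub_const (measurable_pi_apply k).aestronglyMeasurable]
      have h := (measurePreserving_eval_infinitePi (fun k ↦ gaussianReal (m k) (v k)) k).map_eq
      rw [← variance_id_gaussianReal (μ := m k), ← h, 
        variance_map aemeasurable_id (measurable_pi_apply k).aemeasurable]
      rfl
    · refine IndepFun.covariance_eq_zero ?_ (hX k) (hX l)
      exact (iIndepFun_infinitePi (P := fun k ↦ gaussianReal (m k) (v k))
        (X := fun k y ↦ a k * (y - m k)) (by fun_prop)).indepFun hkl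
  have h := covariance_eq_sub (memLp_gaussianScore m a v m i) (memLp_gaussianScore m a v m j)
  simp only [integral_gaussianScore, sub_self, mul_zero, Finset.sum_const_zero, sub_zero] at h
  refine h.symm.trans ?_
  rw [hS, hS, covariance_sum_sum' (fun k _ ↦ hX k) (fun k _ ↦ hX k), gaussianInfo]
  refine Finset.sum_congr rfl fun k hk ↦ ?_
  simp only [hcov]
  rw [Finset.sum_ite_eq, if_pos]
  exact Finset.range_mono hij hk

variable {v} {l : ℝ}

/-- The likelihood ratio of two Gaussian sequences at finite `L²` distance is the exponential of
the `L²` limit of the finite-dimensional log-likelihood ratios. -/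
theorem exists_gaussianSeq_eq_withDensity (hv : ∀ k, v k ≠ 0)
    (hl : Tendsto (gaussianInfo a v) atTop (𝓝 l)) :
    ∃ S : (ℕ → ℝ) → ℝ, Measurable S ∧
      gaussianSeq (fun k ↦ m k + a k * v k) v =
        (gaussianSeq m v).withDensity (fun x ↦ ENNReal.ofReal (Real.exp (S x - l / 2))) ∧
      Integrable S (gaussianSeq (fun k ↦ m k + a k * v k) v) ∧
      ∫ x, S x ∂gaussianSeq (fun k ↦ m k + a k * v k) v = l := by
  obtain ⟨S, hSm, hS2, hSlim, hSint⟩ := exists_memLp_two_of_integral_mul_eq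
    (memLp_gaussianScore m a v m) (fun i j hij ↦ integral_gaussianScore_mul m a v hij) hl
  obtain ⟨M, -, hM2, hMlim, hMint⟩ := exists_memLp_two_of_integral_mul_eq
    (memLp_gaussianLikelihood m a hv) (fun i j hij ↦ integral_gaussianLikelihood_mul m a hv hij)
    ((Real.continuous_exp.tendsto l).comp hl)
  have hMS : M =ᵐ[gaussianSeq m v] fun x ↦ Real.exp (S x - l / 2) := by
    obtain ⟨ns, hns, hSae⟩ := hSlim.exists_seq_tendsto_ae
    obtain ⟨ms, hms, hMae⟩ := (hMlim.comp hns.tendsto_atTop).exists_seq_tendsto_ae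
    filter_upwards [hSae, hMae] with x hSx hMx
    have hsub := hns.tendsto_atTop.comp hms.tendsto_atTop
    refine tendsto_nhds_unique hMx ((Real.continuous_exp.tendsto _).comp ?_)
    exact (hSx.comp hms.tendsto_atTop).sub ((hl.comp hsub).div_const 2)
  have hdens : Measurable fun x ↦ ENNReal.ofReal (Real.exp (S x - l / 2)) := by fun_prop
  have hE2 : MemLp (fun x ↦ Real.exp (S x - l / 2)) 2 (gaussianSeq m v) := hM2.ae_eq hMS
  have heq : gaussianSeq (fun k ↦ m k + a k * v k) v =
      (gaussianSeq m v).withDensity (fun x ↦ ENNReal.ofReal (Real.exp (S x - l / 2))) := by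
    refine (Measure.eq_infinitePi _ fun s t ht ↦ ?_).symm
    have hst : MeasurableSet (Set.pi (s : Set ℕ) t) :=
      MeasurableSet.pi s.countable_toSet fun k _ ↦ ht k
    have hlim := hMint ((Set.pi s t).indicator 1) (memLp_indicator_const 2 hst 1 (by simp))
    obtain ⟨N, hN⟩ := s.exists_nat_subset_range
    have hval : ∫ x, M x * (Set.pi s t).indicator 1 x ∂gaussianSeq m v =
        ∏ k ∈ s, (gaussianReal (m k + a k * v k) (v k)).real (t k) := by
      refine tendsto_nhds_unique hlim (tendsto_const_nhds.congr' ?_)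
      filter_upwards [eventually_ge_atTop N] with n hn
      exact (setIntegral_gaussianLikelihood m a hv ht (hN.trans (Finset.range_mono hn))).symm
    have hset : ∫ x in Set.pi s t, Real.exp (S x - l / 2) ∂gaussianSeq m v =
        ∏ k ∈ s, (gaussianReal (m k + a k * v k) (v k)).real (t k) := by
      rw [← hval, ← integral_indicator hst]
      refine integral_congr_ae ?_
      filter_upwards [hMS] with x hx
      by_cases hxs : x ∈ Set.pi (s : Set ℕ) t <;> simp [hxs, hx]
    rw [withDensity_apply _ hst, ← ofReal_integral_eq_lintegral_ofReal
      (hE2.integrable (by simp)).integrableOn (ae_of_all _ fun _ ↦ (Real.exp_pos _).le), hset,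
      ENNReal.ofReal_prod_of_nonneg fun _ _ ↦ measureReal_nonneg]
    exact Finset.prod_congr rfl fun k _ ↦ ofReal_measureReal
  have hint (f : (ℕ → ℝ) → ℝ) : ∫ x, f x ∂gaussianSeq (fun k ↦ m k + a k * v k) v =
      ∫ x, f x * M x ∂gaussianSeq m v := by
    rw [heq, integral_withDensity_eq_integral_toReal_smul hdens (by simp)]
    refine integral_congr_ae ?_
    filter_upwards [hMS] with x hx
    simp [hx, (Real.exp_pos _).le, mul_comm]
  refine ⟨S, hSm, heq, ?_, ?_⟩
  · rw [heq, integrable_withDensity_iff hdens (by simp)]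
    simp only [ENNReal.toReal_ofReal (Real.exp_pos _).le]
    exact hS2.integrable_mul hE2
  · rw [hint]
    refine tendsto_nhds_unique (hSint M hM2) (hl.congr fun n ↦ ?_)
    rw [← hint, integral_gaussianScore, gaussianInfo]
    refine Finset.sum_congr rfl fun k _ ↦ ?_
    ring

/-- The Kullback-Leibler divergence of Gaussian sequences that differ by the shift `a * v`. -/
theorem klDiv_gaussianSeq (hv : ∀ k, v k ≠ 0) (hl : Tendsto (gaussianInfo a v) atTop (𝓝 l)) :
    klDiv (gaussianSeq (fun k ↦ m k + a k * v k) v) (gaussianSeq m v) = ((l / 2 : ℝ) : EReal) := by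
  obtain ⟨S, hSm, heq, hSi, hS⟩ := exists_gaussianSeq_eq_withDensity m a hv hl
  have hac : gaussianSeq (fun k ↦ m k + a k * v k) v ≪ gaussianSeq m v :=
    heq ▸ withDensity_absolutelyContinuous _ _
  have hllr : llr (gaussianSeq (fun k ↦ m k + a k * v k) v) (gaussianSeq m v)
      =ᵐ[gaussianSeq (fun k ↦ m k + a k * v k) v] fun x ↦ S x - l / 2 := by
    refine hac.ae_le ?_
    have h := Measure.rnDeriv_withDensity (gaussianSeq m v)
      (f := fun x ↦ ENNReal.ofReal (Real.exp (S x - l / 2))) (by fun_prop)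
    rw [← heq] at h
    filter_upwards [h] with x hx
    simp [llr, hx, (Real.exp_pos _).le]
  rw [klDiv, if_pos ⟨hac, (integrable_congr hllr).2 (hSi.sub (integrable_const _))⟩,
    integral_congr_ae hllr, integral_sub hSi (integrable_const _), hS]
  norm_num
  norm_cast
  ring

end GaussianSequence

/-- Kullback–Leibler divergence in the heteroscedastic Gaussian sequence model: if `P_θ`
and `P_θ'` are the countable products of the Gaussian measures `N(θ_k, ε²σ_k²)` and
`N(θ'_k, ε²σ_k²)` and `Σ_k (θ_k − θ'_k)²/σ_k² < ∞`, then
`KL(P_θ, P_θ') = (1/(2ε²)) Σ_k (θ_k − θ'_k)²/σ_k²`. -/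
theorem klDiv_gaussian_sequence (ε : ℝ) (hε : 0 < ε) (σ : ℕ → ℝ) (hσ : ∀ k, 0 < σ k)
    (θ θ' : ℕ → ℝ) (hsum : Summable fun k : ℕ => (θ k - θ' k) ^ 2 / σ k ^ 2)
    (P P' : Measure (ℕ → ℝ)) [IsProbabilityMeasure P] [IsProbabilityMeasure P']
    (hP : IsProjectiveLimit P
      (fun J : Finset ℕ => Measure.pi fun j : J =>
        gaussianReal (θ j) (Real.toNNReal (ε ^ 2 * σ j ^ 2))))
    (hP' : IsProjectiveLimit P'
      (fun J : Finset ℕ => Measure.pi fun j : J =>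
        gaussianReal (θ' j) (Real.toNNReal (ε ^ 2 * σ j ^ 2)))) :
    klDiv P P' =
      ((1 / (2 * ε ^ 2) * ∑' k : ℕ, (θ k - θ' k) ^ 2 / σ k ^ 2 : ℝ) : EReal) := by
  let v (k : ℕ) : ℝ≥0 := Real.toNNReal (ε ^ 2 * σ k ^ 2)
  let a (k : ℕ) : ℝ := (θ k - θ' k) / (ε ^ 2 * σ k ^ 2)
  have hpos (k : ℕ) : 0 < ε ^ 2 * σ k ^ 2 := by
    have := hσ k
    positivity
  have hvr (k : ℕ) : (v k : ℝ) = ε ^ 2 * σ k ^ 2 := Real.coe_toNNReal _ (hpos k).le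
  have hv (k : ℕ) : v k ≠ 0 := (Real.toNNReal_pos.2 (hpos k)).ne'
  have hθ : θ = fun k ↦ θ' k + a k * v k := by
    ext k
    rw [hvr, div_mul_cancel₀ _ (hpos k).ne']
    ring
  have hPθ : P = gaussianSeq θ v :=
    hP.unique (Measure.isProjectiveLimit_infinitePi fun k ↦ gaussianReal (θ k) (v k))
  have hPθ' : P' = gaussianSeq θ' v :=
    hP'.unique (Measure.isProjectiveLimit_infinitePi fun k ↦ gaussianReal (θ' k) (v k))
  have hl : Tendsto (gaussianInfo a v) atTop
      (𝓝 (1 / ε ^ 2 * ∑' k : ℕ, (θ k - θ' k) ^ 2 / σ k ^ 2)) := by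
    refine (hsum.hasSum.mul_left (1 / ε ^ 2)).tendsto_sum_nat.congr fun n ↦ ?_
    refine Finset.sum_congr rfl fun k _ ↦ ?_
    have := (hσ k).ne'
    rw [hvr]
    simp only [a]
    field_simp
  have h := klDiv_gaussianSeq θ' a hv hl
  rw [← hθ, ← hPθ, ← hPθ'] at h
  rw [h]
  congr 1
  ring
end

section
/- (Varshamov–Gilbert bound) Fix an integer m ≥ 8. Then there exist an integer M with M ≥ 2^{m/8} and elements δ^{(0)}, δ^{(1)}, …, δ^{(M)} of {0,1}^m such that δ^{(0)} = (0,…,0) and for all 0 ≤ j < k ≤ M the Hamming distance satisfies ρ(δ^{(j)}, δ^{(k)}) ≥ m/8. -/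
open Finset in
/-- The generating function of Hamming distances from a fixed binary word. -/
theorem sum_pow_hammingDist {m : ℕ} (c : Fin m → Fin 2) (x : ℝ) :
    ∑ y : Fin m → Fin 2, x ^ hammingDist c y = (1 + x) ^ m := by
  have h (y : Fin m → Fin 2) :
      x ^ hammingDist c y = ∏ i, (if c i ≠ y i then x else 1) := by
    rw [prod_ite, prod_const_one, mul_one, prod_const, hammingDist]
  have hc (a : Fin 2) : ∑ b : Fin 2, (if a ≠ b then x else 1) = 1 + x := by
    fin_cases a <;> simp [add_comm]
  simp_rw [h]
  rw [← Fintype.piFinset_univ,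
    ← prod_univ_sum (fun _ => univ) fun i b => if c i ≠ b then x else 1]
  simp_rw [hc]
  simp

open Finset in
/-- A Chernoff-type bound on the size of a Hamming ball in the binary cube. -/
theorem card_hammingDist_lt_le {m : ℕ} (c : Fin m → Fin 2) (r : ℝ) :
    (#{y : Fin m → Fin 2 | (hammingDist c y : ℝ) < r} : ℝ) ≤ (3 / 2) ^ m * 2 ^ r := by
  have h : ∀ y ∈ ({y : Fin m → Fin 2 | (hammingDist c y : ℝ) < r} : Finset _),
      (1 : ℝ) ≤ (1 / 2) ^ hammingDist c y * 2 ^ r := by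
    intro y hy
    rw [one_div, inv_pow, ← Real.rpow_natCast, inv_mul_eq_div, one_le_div (by positivity)]
    exact Real.rpow_le_rpow_of_exponent_le one_le_two (mem_filter.mp hy).2.le
  calc (#{y : Fin m → Fin 2 | (hammingDist c y : ℝ) < r} : ℝ)
      = ∑ y : Fin m → Fin 2 with (hammingDist c y : ℝ) < r, (1 : ℝ) := by simp
    _ ≤ ∑ y : Fin m → Fin 2 with (hammingDist c y : ℝ) < r,
          (1 / 2) ^ hammingDist c y * 2 ^ r := sum_le_sum h
    _ ≤ ∑ y : Fin m → Fin 2, (1 / 2) ^ hammingDist c y * 2 ^ r :=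
        sum_le_sum_of_subset_of_nonneg (subset_univ _) fun _ _ _ => by positivity
    _ = (3 / 2) ^ m * 2 ^ r := by
        rw [← sum_mul, sum_pow_hammingDist]
        norm_num

open Finset in
/-- A maximal separated binary code containing the zero word covers the cube. -/
theorem exists_separated_covering_code (m : ℕ) (r : ℝ) :
    ∃ C : Finset (Fin m → Fin 2), 0 ∈ C ∧
      (C : Set (Fin m → Fin 2)).Pairwise (fun x y => r ≤ (hammingDist x y : ℝ)) ∧
      ∀ y, y ∉ C → ∃ c ∈ C, (hammingDist c y : ℝ) < r := by
  let P : Finset (Fin m → Fin 2) → Prop := fun C =>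
    0 ∈ C ∧ (C : Set (Fin m → Fin 2)).Pairwise (fun x y => r ≤ (hammingDist x y : ℝ))
  obtain ⟨C, -, hC⟩ := (Set.toFinite {C | P C}).exists_le_maximal
    (show ({0} : Finset (Fin m → Fin 2)) ∈ {C | P C} from ⟨by simp, by simp⟩)
  refine ⟨C, hC.prop.1, hC.prop.2, fun y hy => ?_⟩
  by_contra! hfar
  refine hy (hC.le_of_ge (y := insert y C) ⟨mem_insert_of_mem hC.prop.1, ?_⟩
    (subset_insert y C) (mem_insert_self y C))
  rw [coe_insert]
  exact hC.prop.2.insert fun c hc _ => ⟨hammingDist_comm c y ▸ hfar c hc, hfar c hc⟩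

open Finset in
/-- The Gilbert lower bound for a separated binary code containing the zero word. -/
theorem exists_large_separated_code (m : ℕ) (r : ℝ) (hr : 0 < r) :
    ∃ C : Finset (Fin m → Fin 2), 0 ∈ C ∧
      (C : Set (Fin m → Fin 2)).Pairwise (fun x y => r ≤ (hammingDist x y : ℝ)) ∧
      (2 : ℝ) ^ m ≤ #C * ((3 / 2) ^ m * 2 ^ r) := by
  obtain ⟨C, h0, hsep, hcov⟩ := exists_separated_covering_code m r
  refine ⟨C, h0, hsep, ?_⟩
  have hU : (univ : Finset (Fin m → Fin 2)) ⊆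
      C.biUnion fun c => {y : Fin m → Fin 2 | (hammingDist c y : ℝ) < r} := by
    intro y _
    simp only [mem_biUnion, mem_filter, mem_univ, true_and]
    by_cases hy : y ∈ C
    · exact ⟨y, hy, by simpa using hr⟩
    · exact hcov y hy
  calc (2 : ℝ) ^ m = (#(univ : Finset (Fin m → Fin 2)) : ℝ) := by simp
    _ ≤ ∑ c ∈ C, (#{y : Fin m → Fin 2 | (hammingDist c y : ℝ) < r} : ℝ) := by
        exact_mod_cast (card_le_card hU).trans card_biUnion_le
    _ ≤ ∑ _c ∈ C, (3 / 2 : ℝ) ^ m * 2 ^ r := sum_le_sum fun c _ => card_hammingDist_lt_le c r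
    _ = #C * ((3 / 2) ^ m * 2 ^ r) := by rw [sum_const, nsmul_eq_mul]

/-- A nonempty finset can be enumerated starting from any of its elements. -/
theorem Finset.exists_injective_enumeration {α : Type*} {s : Finset α} {a : α} (ha : a ∈ s)
    {M : ℕ} (hM : s.card = M + 1) :
    ∃ f : Fin (M + 1) → α, Function.Injective f ∧ f 0 = a ∧ ∀ i, f i ∈ s := by
  let e := (s.equivFinOfCardEq hM).symm
  let g := (Equiv.swap 0 (e.symm ⟨a, ha⟩)).trans e
  exact ⟨fun i => g i, Subtype.val_injective.comp g.injective, by simp [g], fun i => (g i).2⟩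

/-- Varshamov–Gilbert bound: for every integer `m ≥ 8` there exist `M ≥ 2^(m/8)` and
elements `δ⁽⁰⁾, …, δ⁽ᴹ⁾` of `{0,1}^m` with `δ⁽⁰⁾ = (0,…,0)` and pairwise Hamming
distances at least `m/8`. -/
theorem varshamov_gilbert (m : ℕ) (hm : 8 ≤ m) :
    ∃ (M : ℕ) (δ : Fin (M + 1) → Fin m → Fin 2),
      (2 : ℝ) ^ ((m : ℝ) / 8) ≤ (M : ℝ) ∧
      δ 0 = (fun _ => 0) ∧
      ∀ j k : Fin (M + 1), j < k → (m : ℝ) / 8 ≤ (hammingDist (δ j) (δ k) : ℝ) := by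
  have hm' : (8 : ℝ) ≤ m := by exact_mod_cast hm
  obtain ⟨C, h0, hsep, hcard⟩ := exists_large_separated_code m ((m : ℝ) / 8) (by positivity)
  obtain ⟨M, hM⟩ := Nat.exists_eq_succ_of_ne_zero (Finset.card_ne_zero_of_mem h0)
  obtain ⟨δ, hinj, hδ0, hδ⟩ := Finset.exists_injective_enumeration h0 hM
  refine ⟨M, δ, ?_, hδ0, fun j k hjk => hsep (hδ j) (hδ k) (hinj.ne hjk.ne)⟩
  set t : ℝ := 2 ^ ((m : ℝ) / 8) with ht
  have ht2 : 2 ≤ t := by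
    simpa using Real.rpow_le_rpow_of_exponent_le one_le_two
      (show (1 : ℝ) ≤ (m : ℝ) / 8 by linarith)
  have ht8 : t ^ 8 = 2 ^ m := by
    rw [ht, ← Real.rpow_mul_natCast zero_le_two, ← Real.rpow_natCast]
    congr 1
    push_cast
    ring
  have h32 : (3 / 2 : ℝ) ^ m ≤ t ^ 5 := by
    refine le_of_pow_le_pow_left₀ (n := 8) (by norm_num) (by positivity) ?_
    calc ((3 / 2 : ℝ) ^ m) ^ 8 = ((3 / 2) ^ 8) ^ m := pow_right_comm _ _ _
      _ ≤ (2 ^ 5) ^ m := by gcongr; norm_num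
      _ = (t ^ 5) ^ 8 := by rw [pow_right_comm, ← ht8, pow_right_comm]
  rw [hM, ← ht8, Nat.cast_succ] at hcard
  have hM2 : t ^ 2 ≤ (M : ℝ) + 1 := by
    refine le_of_mul_le_mul_right ?_ (show 0 < t ^ 6 by positivity)
    calc t ^ 2 * t ^ 6 = t ^ 8 := by ring
      _ ≤ ((M : ℝ) + 1) * ((3 / 2) ^ m * t) := hcard
      _ ≤ ((M : ℝ) + 1) * (t ^ 5 * t) := by gcongr
      _ = ((M : ℝ) + 1) * t ^ 6 := by ring
  nlinarith
end

section
/- (Fano-type lemma) Let η > 0, let M ≥ 5 be an integer, let (Ω, 𝒜) be a measurable space carrying probability measures P_0, P_1, …, P_M, and let f_0, f_1, …, f_M be elements of a normed vector space V such that (i) ‖f_i − f_j‖ ≥ η for all 0 ≤ i < j ≤ M, and (ii) P_j ≪ P_0 and KL(P_j, P_0) ≤ H for all j = 1,…,M, where H < log M. Then for every measurable map f̂ : Ω → V and every nondecreasing function ℓ : [0,∞) → [0,∞): max_{0 ≤ j ≤ M} ∫ ℓ(‖f̂(ω) − f_j‖) dP_j(ω) ≥ ℓ(η/2) · (1 −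 max(2/3, H/log M)). -/
open MeasureTheory ProbabilityTheory Classical

/-- The Donsker–Varadhan inequality for a multiple of the indicator of an event. -/
theorem mul_measureReal_le_integral_llr_add_log {Ω : Type*} [MeasurableSpace Ω]
    {μ ν : Measure Ω} [IsProbabilityMeasure μ] [IsProbabilityMeasure ν]
    (hμν : μ ≪ ν) (hint : Integrable (llr μ ν) μ) {A : Set Ω} (hA : MeasurableSet A) (t : ℝ) :
    t * μ.real A ≤
      (∫ x, llr μ ν x ∂μ) + Real.log (1 + (Real.exp t - 1) * ν.real A) := by
  set g : Ω → ℝ := A.indicator fun _ => t with hg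
  have hgμ : Integrable g μ := (integrable_const t).indicator hA
  have hexp : (fun x => Real.exp (g x)) =
      fun x => 1 + A.indicator (fun _ => Real.exp t - 1) x := by
    ext x
    by_cases hx : x ∈ A <;> simp [hg, hx]
  have hexpint : Integrable (fun x => Real.exp (g x)) ν := by
    rw [hexp]
    exact (integrable_const _).add ((integrable_const _).indicator hA)
  have hexpval : ∫ x, Real.exp (g x) ∂ν = 1 + (Real.exp t - 1) * ν.real A := by
    rw [hexp, integral_add (integrable_const _) ((integrable_const _).indicator hA),
      integral_indicator_const _ hA]
    simp [mul_comm]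
  have hgval : ∫ x, g x ∂μ = t * μ.real A := by
    rw [hg, integral_indicator_const _ hA]
    simp [mul_comm]
  have := isProbabilityMeasure_tilted hexpint
  have hnonneg := InformationTheory.integral_llr_add_sub_measure_univ_nonneg
    (hμν.trans (absolutelyContinuous_tilted hexpint))
    (integrable_llr_tilted_right hμν hgμ hint hexpint)
  rw [integral_llr_tilted_right hμν hgμ hexpint hint, hgval, hexpval] at hnonneg
  simp only [probReal_univ] at hnonneg
  linarith

/-- If `KL(μ, ν) ≤ H` and the event `A` has `ν`-probability at most `1 / (3 m)` and `μ`-probability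
more than `2 / 3`, then `μ A * log m < H`. -/
theorem measureReal_mul_log_lt_of_klDiv_le {Ω : Type*} [MeasurableSpace Ω]
    {μ ν : Measure Ω} [IsProbabilityMeasure μ] [IsProbabilityMeasure ν] {H m : ℝ}
    (hKL : klDiv μ ν ≤ (H : EReal)) (hm : 1 ≤ m) {A : Set Ω} (hA : MeasurableSet A)
    (hν : ν.real A ≤ 1 / (3 * m)) (hμ : 2 / 3 < μ.real A) :
    μ.real A * Real.log m < H := by
  unfold klDiv at hKL
  split_ifs at hKL with h
  · have hle : ∫ x, llr μ ν x ∂μ ≤ H := EReal.coe_le_coe_iff.mp hKL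
    have hDV := mul_measureReal_le_integral_llr_add_log h.1 h.2 hA (Real.log (3 * m))
    rw [Real.exp_log (by positivity), Real.log_mul (by norm_num) (by positivity)] at hDV
    have hq : (3 * m - 1) * ν.real A ≤ 1 := by
      rw [le_div_iff₀ (by positivity)] at hν
      nlinarith [measureReal_nonneg (μ := ν) (s := A)]
    have hq0 : 0 ≤ (3 * m - 1) * ν.real A :=
      mul_nonneg (by linarith) measureReal_nonneg
    have hlog : Real.log (1 + (3 * m - 1) * ν.real A) ≤ Real.log 2 :=
      Real.log_le_log (by linarith) (by linarith)
    have h32 : 3 * Real.log 2 < 2 * Real.log 3 := by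
      have := Real.log_lt_log (x := 2 ^ 3) (y := 3 ^ 2) (by norm_num) (by norm_num)
      rw [Real.log_pow, Real.log_pow] at this
      exact_mod_cast this
    have h3 : 0 < Real.log 3 := Real.log_pos (by norm_num)
    nlinarith
  · exact absurd hKL (not_le.mpr (EReal.coe_lt_top H))

/-- For pairwise disjoint events `A 0, …, A M` with `ν (A 0) ≥ 2 / 3`, one of `A 1, …, A M` has
probability at most `1 / (3 M)`. -/
theorem exists_measureReal_succ_le {Ω : Type*} [MeasurableSpace Ω] {ν : Measure Ω}
    [IsProbabilityMeasure ν] {M : ℕ} (hM : 0 < M) {A : Fin (M + 1) → Set Ω}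
    (hA : ∀ j, MeasurableSet (A j)) (hdisj : Pairwise (Function.onFun Disjoint A))
    (h0 : 2 / 3 ≤ ν.real (A 0)) :
    ∃ i : Fin M, ν.real (A i.succ) ≤ 1 / (3 * M) := by
  by_contra! hlt
  have hsum : ∑ j, ν.real (A j) ≤ 1 := by
    rw [← measureReal_iUnion_fintype hdisj hA]
    exact measureReal_le_one
  have : Nonempty (Fin M) := ⟨⟨0, hM⟩⟩
  have hgt : ∑ _i : Fin M, (1 / (3 * M) : ℝ) < ∑ i : Fin M, ν.real (A i.succ) :=
    Finset.sum_lt_sum_of_nonempty Finset.univ_nonempty fun i _ => hlt i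
  have hval : ∑ _i : Fin M, (1 / (3 * M) : ℝ) = 1 / 3 := by
    simp only [Finset.sum_const, Finset.card_univ, Fintype.card_fin, nsmul_eq_mul]
    field_simp
  rw [Fin.sum_univ_succ] at hsum
  linarith

/-- A small expected loss forces the estimator to be within `r` of the target with large
probability. -/
theorem lt_measureReal_preimage_ball_of_lintegral_lt {Ω V : Type*} [MeasurableSpace Ω]
    [NormedAddCommGroup V] [MeasurableSpace V] [BorelSpace V]
    {μ : Measure Ω} [IsProbabilityMeasure μ] {g : Ω → V} (hg : Measurable g) (v : V)
    {r κ : ℝ} (hr : 0 ≤ r) {ℓ : ℝ → ℝ} (hℓ : MonotoneOn ℓ (Set.Ici 0)) (hℓr : 0 ≤ ℓ r)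
    (hlt : ∫⁻ ω, ENNReal.ofReal (ℓ ‖g ω - v‖) ∂μ < ENNReal.ofReal (ℓ r * (1 - κ))) :
    κ < μ.real (g ⁻¹' Metric.ball v r) := by
  have hA : MeasurableSet (g ⁻¹' Metric.ball v r) := hg Metric.isOpen_ball.measurableSet
  have hle : ENNReal.ofReal (ℓ r * μ.real (g ⁻¹' Metric.ball v r)ᶜ) ≤
      ∫⁻ ω, ENNReal.ofReal (ℓ ‖g ω - v‖) ∂μ := by
    rw [ENNReal.ofReal_mul hℓr, ofReal_measureReal, ← lintegral_indicator_const hA.compl]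
    refine lintegral_mono (Set.indicator_le fun ω hω => ?_)
    have hω' : r ≤ ‖g ω - v‖ := by simpa [dist_eq_norm] using hω
    exact ENNReal.ofReal_le_ofReal (hℓ hr (norm_nonneg _) hω')
  have hlt' := (ENNReal.ofReal_lt_ofReal_iff_of_nonneg
    (mul_nonneg hℓr measureReal_nonneg)).mp (hle.trans_lt hlt)
  rw [probReal_compl_eq_one_sub hA] at hlt'
  linarith [lt_of_mul_lt_mul_left hlt' hℓr]

/-- Fano-type lemma: given `η > 0`, an integer `M ≥ 5`, probability measures
`P_0, …, P_M` on `(Ω, 𝒜)` and points `f_0, …, f_M` of a normed space `V` such that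
`‖f_i − f_j‖ ≥ η` for `i < j`, `P_j ≪ P_0` and `KL(P_j, P_0) ≤ H < log M` for `j ≥ 1`,
then for every measurable `f̂ : Ω → V` and every nondecreasing `ℓ : [0,∞) → [0,∞)`,
`max_j ∫ ℓ(‖f̂ − f_j‖) dP_j ≥ ℓ(η/2) (1 − max(2/3, H/log M))`. -/
theorem fano_lemma {Ω : Type*} [MeasurableSpace Ω]
    {V : Type*} [NormedAddCommGroup V] [MeasurableSpace V] [BorelSpace V]
    (η H : ℝ) (hη : 0 < η) (M : ℕ) (hM : 5 ≤ M)
    (P : Fin (M + 1) → Measure Ω) (hprob : ∀ j, IsProbabilityMeasure (P j))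
    (f : Fin (M + 1) → V)
    (hsep : ∀ i j : Fin (M + 1), i < j → η ≤ ‖f i - f j‖)
    (hac : ∀ j : Fin (M + 1), j ≠ 0 → P j ≪ P 0)
    (hKL : ∀ j : Fin (M + 1), j ≠ 0 → klDiv (P j) (P 0) ≤ (H : EReal))
    (hH : H < Real.log M)
    (fhat : Ω → V) (hfhat : Measurable fhat)
    (ℓ : ℝ → ℝ) (hℓ : MonotoneOn ℓ (Set.Ici 0)) (hℓ0 : ∀ x ∈ Set.Ici (0 : ℝ), 0 ≤ ℓ x) :
    ∃ j : Fin (M + 1),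
      ENNReal.ofReal (ℓ (η / 2) * (1 - max (2 / 3) (H / Real.log M))) ≤
        ∫⁻ ω, ENNReal.ofReal (ℓ ‖fhat ω - f j‖) ∂(P j) := by
  by_contra! hlt
  set κ : ℝ := max (2 / 3) (H / Real.log M)
  set A : Fin (M + 1) → Set Ω := fun j => fhat ⁻¹' Metric.ball (f j) (η / 2)
  have hA : ∀ j, MeasurableSet (A j) := fun j => hfhat Metric.isOpen_ball.measurableSet
  have hκ : ∀ j, κ < (P j).real (A j) := fun j =>
    lt_measureReal_preimage_ball_of_lintegral_lt hfhat (f j) (by positivity) hℓ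
      (hℓ0 _ (Set.mem_Ici.mpr (by positivity))) (hlt j)
  have hdisj : Pairwise (Function.onFun Disjoint A) := by
    intro i j hij
    refine Disjoint.preimage fhat (Metric.ball_disjoint_ball ?_)
    rw [add_halves, dist_eq_norm]
    rcases lt_or_gt_of_ne hij with h | h
    · exact hsep i j h
    · rw [norm_sub_rev]
      exact hsep j i h
  have h23 : ∀ j, 2 / 3 < (P j).real (A j) := fun j => (le_max_left _ _).trans_lt (hκ j)
  obtain ⟨i, hi⟩ := exists_measureReal_succ_le (ν := P 0) (by omega) hA hdisj (h23 0).le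
  have hM1 : (1 : ℝ) < M := by exact_mod_cast (by omega : 1 < M)
  have hub := measureReal_mul_log_lt_of_klDiv_le (hKL i.succ i.succ_ne_zero) hM1.le
    (hA i.succ) hi (h23 i.succ)
  have hlb : H / Real.log M < (P i.succ).real (A i.succ) :=
    (le_max_right _ _).trans_lt (hκ i.succ)
  rw [div_lt_iff₀ (Real.log_pos hM1)] at hlb
  linarith
end

section
/- (Minimax lower bound) Let r > 0 and let σ_k² = ((2k+1)/2) · 4^{−k} · Σ_{j=0}^{⌊k/2⌋} (C(k,j) · C(2k−2j, k))² for k ∈ ℕ. There exist constants c > 0 and ε₀ ∈ (0,1), depending only on r, such that for every ε ∈ (0, ε₀) and every measurable estimator f̂ : ℝ^ℕ → ℓ²(ℕ): sup over θ ∈ ℓ²(ℕ) with Σ_{k≥1} k^{2r} θ_k² ≤ 1 of ∫ ‖f̂(y) − θ‖²_{ℓ²} dP_θ(y) ≥ c · (log(1/ε))^{−2r}, where P_θ is the countable product probability measure on ℝ^ℕ whose k-th factor is the Gaussian measure N(θ_k, ε² σ_k²). -/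
open MeasureTheory ProbabilityTheory Finset ENNReal

/-- Changing one factor of a countable product of probability measures amounts to resampling the
corresponding coordinate. -/
lemma infinitePi_eq_map_update {ι : Type*} [DecidableEq ι] {X : ι → Type*}
    [∀ i, MeasurableSpace (X i)] (μ ν : (i : ι) → Measure (X i))
    [∀ i, IsProbabilityMeasure (μ i)] [∀ i, IsProbabilityMeasure (ν i)] (k : ι)
    (h : ∀ i, i ≠ k → μ i = ν i) :
    Measure.infinitePi ν =
      ((Measure.infinitePi μ).prod (ν k)).map (fun p => Function.update p.1 k p.2) := by
  symm
  refine Measure.eq_infinitePi ν fun s t ht => ?_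
  rw [Measure.map_apply measurable_update'
    (MeasurableSet.pi s.countable_toSet fun i _ => ht i)]
  have hset : (fun p : ((i : ι) → X i) × X k => Function.update p.1 k p.2) ⁻¹' Set.pi s t =
      Set.pi (s.erase k : Finset ι) t ×ˢ {x | k ∈ s → x ∈ t k} := by
    ext p
    simp only [Set.mem_preimage, Set.update_mem_pi_iff, Set.mem_prod, Finset.coe_erase]
    rfl
  rw [hset, Measure.prod_prod, Measure.infinitePi_pi μ fun i _ => ht i,
    Finset.prod_congr rfl fun i hi => by rw [h i (Finset.ne_of_mem_erase hi)]]
  by_cases hk : k ∈ s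
  · simp only [hk, true_imp_iff]
    exact Finset.prod_erase_mul s (fun i => ν i (t i)) hk
  · simp [hk]

lemma two_pow_div_four_le_sigmaSq {k : ℕ} (hk : 0 < k) : (2 : ℝ) ^ k / 4 ≤ sigmaSq k := by
  have hk' : (0 : ℝ) < k := by exact_mod_cast hk
  have h1 : (4 : ℝ) ^ k / (2 * k) ≤ (2 * k).choose k := by
    rw [div_le_iff₀ (by positivity), mul_comm]
    exact_mod_cast Nat.four_pow_le_two_mul_self_mul_centralBinom k hk
  have h2 : ((2 * k).choose k : ℝ) ^ 2 ≤ ∑ j ∈ Finset.range (k / 2 + 1),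
      ((k.choose j : ℝ) * ((2 * k - 2 * j).choose k : ℝ)) ^ 2 := by
    have := Finset.single_le_sum
      (f := fun j => ((k.choose j : ℝ) * ((2 * k - 2 * j).choose k : ℝ)) ^ 2)
      (fun j _ => sq_nonneg _) (Finset.mem_range.2 (Nat.succ_pos (k / 2)))
    simpa using this
  have h3 : (k : ℝ) ≤ 2 ^ k := by exact_mod_cast Nat.lt_two_pow_self.le
  have h4 : (4 : ℝ) ^ k = 2 ^ k * 2 ^ k := by rw [← mul_pow]; norm_num
  calc (2 : ℝ) ^ k / 4 ≤ 2 ^ k * 2 ^ k / (4 * k) := by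
        rw [div_le_div_iff₀ (by norm_num) (by positivity)]
        nlinarith [mul_le_mul_of_nonneg_left h3 (by positivity : (0 : ℝ) ≤ 4 * 2 ^ k)]
    _ = ((2 * k : ℝ) / 2) / 4 ^ k * ((4 : ℝ) ^ k / (2 * k)) ^ 2 := by
        rw [← h4]; field_simp; norm_num
    _ ≤ ((2 * k + 1 : ℝ) / 2) / 4 ^ k * ((2 * k).choose k : ℝ) ^ 2 := by
        gcongr
        linarith
    _ ≤ sigmaSq k := by
        unfold sigmaSq
        gcongr

/-- On `[0, s]`, a Gaussian of standard deviation `s` and mean in `[0, s]` dominates a multiple of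
the uniform distribution. -/
lemma lintegral_Icc_le_lintegral_gaussianReal {s a : ℝ} (hs : 0 < s) (ha : a ∈ Set.Icc 0 s)
    {f : ℝ → ℝ≥0∞} (hf : Measurable f) :
    ENNReal.ofReal ((√(2 * Real.pi))⁻¹ * Real.exp (-1 / 2) / s) * ∫⁻ x in Set.Icc 0 s, f x ≤
      ∫⁻ x, f x ∂(gaussianReal a (Real.toNNReal (s ^ 2))) := by
  have hv : Real.toNNReal (s ^ 2) ≠ 0 := by
    simpa using hs.ne'
  rw [gaussianReal_of_var_ne_zero _ hv,
    lintegral_withDensity_eq_lintegral_mul _ (measurable_gaussianPDF _ _) hf,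
    ← lintegral_const_mul _ hf]
  refine le_trans (setLIntegral_mono' measurableSet_Icc fun x hx => ?_)
    (setLIntegral_le_lintegral (Set.Icc 0 s) _)
  simp only [Pi.mul_apply, gaussianPDF, gaussianPDFReal]
  refine mul_le_mul_left (ENNReal.ofReal_le_ofReal ?_) _
  rw [Real.coe_toNNReal _ (sq_nonneg s), Real.sqrt_mul (by positivity) (s ^ 2), Real.sqrt_sq hs.le,
    mul_inv, div_eq_mul_inv, mul_right_comm]
  refine mul_le_mul_of_nonneg_left (Real.exp_le_exp.2 ?_) (by positivity)
  rw [div_le_div_iff₀ (by norm_num) (by positivity)]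
  have : (x - a) ^ 2 ≤ s ^ 2 := by
    rw [sq_le_sq, abs_of_pos hs, abs_le]
    constructor <;> linarith [hx.1, hx.2, ha.1, ha.2]
  nlinarith

lemma le_lintegral_gaussianReal_add {s a : ℝ} (hs : 0 < s) (ha : a ∈ Set.Icc 0 s)
    {f g : ℝ → ℝ≥0∞} (hf : Measurable f) (hg : Measurable g) {D : ℝ≥0∞}
    (hD : ∀ x, D ≤ f x + g x) :
    ENNReal.ofReal ((√(2 * Real.pi))⁻¹ * Real.exp (-1 / 2)) * D ≤
      ∫⁻ x, f x ∂(gaussianReal 0 (Real.toNNReal (s ^ 2))) +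
        ∫⁻ x, g x ∂(gaussianReal a (Real.toNNReal (s ^ 2))) := by
  refine le_trans ?_ (add_le_add
    (lintegral_Icc_le_lintegral_gaussianReal hs ⟨le_rfl, hs.le⟩ hf)
    (lintegral_Icc_le_lintegral_gaussianReal hs ha hg))
  rw [← mul_add, ← lintegral_add_left hf]
  calc ENNReal.ofReal ((√(2 * Real.pi))⁻¹ * Real.exp (-1 / 2)) * D
      = ENNReal.ofReal ((√(2 * Real.pi))⁻¹ * Real.exp (-1 / 2) / s) *
          ∫⁻ _ in Set.Icc 0 s, D := by
        rw [setLIntegral_const, Real.volume_Icc, sub_zero, mul_comm D, ← mul_assoc,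
          ← ENNReal.ofReal_mul (by positivity), div_mul_cancel₀ _ hs.ne']
    _ ≤ _ := by gcongr with x; exact hD x

lemma ofReal_sq_norm_div_two_le {E : Type*} [NormedAddCommGroup E] (u t : E) :
    ENNReal.ofReal (‖t‖ ^ 2 / 2) ≤ (‖u‖₊ : ℝ≥0∞) ^ 2 + (‖u - t‖₊ : ℝ≥0∞) ^ 2 := by
  have h : ‖t‖ ≤ ‖u‖ + ‖u - t‖ := by
    simpa using norm_sub_le u (u - t)
  have e : ∀ w : E, (‖w‖₊ : ℝ≥0∞) ^ 2 = ENNReal.ofReal (‖w‖ ^ 2) := fun w => by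
    rw [ENNReal.ofReal_pow (norm_nonneg _), ofReal_norm, enorm_eq_nnnorm]
  rw [e, e, ← ENNReal.ofReal_add (by positivity) (by positivity)]
  apply ENNReal.ofReal_le_ofReal
  nlinarith [sq_nonneg (‖u‖ - ‖u - t‖), norm_nonneg t, norm_nonneg u, norm_nonneg (u - t),
    pow_le_pow_left₀ (norm_nonneg t) h 2]

/-- Two-point bound for product Gaussian measures whose means differ in one coordinate `k`, by at
most the standard deviation `s` of that coordinate. -/
lemma le_lintegral_infinitePi_gaussianReal_add {E : Type*} [NormedAddCommGroup E]
    [MeasurableSpace E] [OpensMeasurableSpace E] {v : ℕ → NNReal} {m : ℕ → ℝ} {k : ℕ} {s : ℝ}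
    (hs : 0 < s) (hv : v k = Real.toNNReal (s ^ 2)) (hm : ∀ j, j ≠ k → m j = 0)
    (hmk : m k ∈ Set.Icc 0 s) {F : (ℕ → ℝ) → E} (hF : Measurable F) (t : E) :
    ENNReal.ofReal ((√(2 * Real.pi))⁻¹ * Real.exp (-1 / 2)) * ENNReal.ofReal (‖t‖ ^ 2 / 2) ≤
      ∫⁻ y, (‖F y‖₊ : ℝ≥0∞) ^ 2 ∂(Measure.infinitePi fun j => gaussianReal 0 (v j)) +
        ∫⁻ y, (‖F y - t‖₊ : ℝ≥0∞) ^ 2 ∂(Measure.infinitePi fun j => gaussianReal (m j) (v j)) := by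
  have hg : ∀ w : E, Measurable fun y => (‖F y - w‖₊ : ℝ≥0∞) ^ 2 := fun w => by
    have : Continuous fun x : E => (‖x - w‖₊ : ℝ≥0∞) ^ 2 := by fun_prop
    exact this.measurable.comp hF
  have hf : Measurable fun y => (‖F y‖₊ : ℝ≥0∞) ^ 2 := by simpa using hg 0
  set μ : ℕ → Measure ℝ := fun j => gaussianReal 0 (v j)
  have hu : Measurable fun p : (ℕ → ℝ) × ℝ => Function.update p.1 k p.2 := measurable_update'
  have hfu : Measurable fun p : (ℕ → ℝ) × ℝ =>
      (‖F (Function.update p.1 k p.2)‖₊ : ℝ≥0∞) ^ 2 := hf.comp hu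
  have hgu : Measurable fun p : (ℕ → ℝ) × ℝ =>
      (‖F (Function.update p.1 k p.2) - t‖₊ : ℝ≥0∞) ^ 2 := (hg t).comp hu
  have hμ := infinitePi_eq_map_update μ μ k fun _ _ => rfl
  have hν := infinitePi_eq_map_update μ (fun j => gaussianReal (m j) (v j)) k
    fun j hj => by simp only [μ, hm j hj]
  rw [hν]
  nth_rw 1 [hμ]
  rw [lintegral_map hf hu, lintegral_map (hg t) hu,
    lintegral_prod _ hfu.aemeasurable, lintegral_prod _ hgu.aemeasurable,
    ← lintegral_add_left hfu.lintegral_prod_right']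
  calc _ = ∫⁻ _, ENNReal.ofReal ((√(2 * Real.pi))⁻¹ * Real.exp (-1 / 2)) *
        ENNReal.ofReal (‖t‖ ^ 2 / 2) ∂(Measure.infinitePi μ) := by simp
    _ ≤ _ := by
      refine lintegral_mono fun y => ?_
      simp only [μ, hv]
      exact le_lintegral_gaussianReal_add hs hmk
        (hfu.comp measurable_prodMk_left) (hgu.comp measurable_prodMk_left)
        fun x => ofReal_sq_norm_div_two_le _ t

lemma one_le_sq_mul_sigmaSq {ε : ℝ} (hε : ε ∈ Set.Ioo 0 (Real.exp (-2))) {k : ℕ}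
    (hk : 8 * Real.log (1 / ε) ≤ k) : 1 ≤ ε ^ 2 * sigmaSq k := by
  have hL : Real.log ε < -2 := by
    rw [Real.log_lt_iff_lt_exp hε.1]; exact hε.2
  rw [one_div, Real.log_inv] at hk
  have hk0 : 0 < k := by
    have : (0 : ℝ) < k := by linarith
    exact_mod_cast this
  refine le_trans ?_ (mul_le_mul_of_nonneg_left (two_pow_div_four_le_sigmaSq hk0) (sq_nonneg ε))
  have h2 : (2 : ℝ) ^ k = Real.exp (Real.log 2 * k) := by
    rw [← Real.rpow_natCast, Real.rpow_def_of_pos two_pos]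
  have hε2 : ε ^ 2 = Real.exp (2 * Real.log ε) := by
    rw [two_mul, Real.exp_add, Real.exp_log hε.1, sq]
  rw [h2, hε2, ← mul_div_assoc, ← Real.exp_add, le_div_iff₀ (by norm_num), one_mul]
  have := Real.add_one_le_exp (2 * Real.log ε + Real.log 2 * k)
  nlinarith [Real.log_two_gt_d9, this]

/-- Minimax lower bound in the Gaussian-sequence-space form of the Hausdorff moment
problem: there are `c > 0` and `ε₀ ∈ (0,1)`, depending only on `r`, such that for every
`ε ∈ (0, ε₀)`, every family `P_θ` of countable products of Gaussians `N(θ_k, ε²σ_k²)` and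
every measurable estimator `f̂ : ℝ^ℕ → ℓ²`, the supremum over the Sobolev ball
`{θ : Σ_{k≥1} k^(2r) θ_k² ≤ 1}` of the risk `∫ ‖f̂(y) − θ‖²_{ℓ²} dP_θ(y)` is at least
`c (log(1/ε))^(−2r)`. -/
theorem minimax_lower_bound (r : ℝ) (hr : 0 < r)
    [MeasurableSpace (lp (fun _ : ℕ => ℝ) 2)] [BorelSpace (lp (fun _ : ℕ => ℝ) 2)] :
    ∃ c : ℝ, 0 < c ∧ ∃ ε₀ ∈ Set.Ioo (0 : ℝ) 1, ∀ ε ∈ Set.Ioo (0 : ℝ) ε₀,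
      ∀ P : lp (fun _ : ℕ => ℝ) 2 → Measure (ℕ → ℝ),
        (∀ θ, IsProbabilityMeasure (P θ)) →
        (∀ θ, IsProjectiveLimit (P θ)
          (fun J : Finset ℕ => Measure.pi fun j : J =>
            gaussianReal (θ j) (Real.toNNReal (ε ^ 2 * sigmaSq j)))) →
        ∀ fhat : (ℕ → ℝ) → lp (fun _ : ℕ => ℝ) 2, Measurable fhat →
          ENNReal.ofReal (c * Real.log (1 / ε) ^ (-(2 * r))) ≤
            ⨆ (θ : lp (fun _ : ℕ => ℝ) 2)
              (_ : Summable fun k : ℕ => (k : ℝ) ^ (2 * r) * θ k ^ 2)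
              (_ : ∑' k : ℕ, (k : ℝ) ^ (2 * r) * θ k ^ 2 ≤ 1),
              ∫⁻ y, (‖fhat y - θ‖₊ : ℝ≥0∞) ^ 2 ∂(P θ) := by
  set κ : ℝ := (√(2 * Real.pi))⁻¹ * Real.exp (-1 / 2) with hκ
  have hκ0 : 0 < κ := by positivity
  refine ⟨κ / 4 * 9 ^ (-(2 * r)), by positivity, Real.exp (-2),
    ⟨Real.exp_pos _, by rw [Real.exp_lt_one_iff]; norm_num⟩, ?_⟩
  intro ε hε P _ hP fhat hfhat
  have hL : 2 < Real.log (1 / ε) := by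
    rw [one_div, Real.log_inv, lt_neg, Real.log_lt_iff_lt_exp hε.1]
    exact hε.2
  set L := Real.log (1 / ε) with hLdef
  set k := ⌈8 * L⌉₊ with hk
  have hkL : 8 * L ≤ k := Nat.le_ceil _
  have hkU : (k : ℝ) ≤ 9 * L := by
    linarith [Nat.ceil_lt_add_one (show 0 ≤ 8 * L by linarith)]
  have hk1 : (1 : ℝ) ≤ k := by linarith
  have hv := one_le_sq_mul_sigmaSq hε hkL
  set a : ℝ := (k : ℝ) ^ (-r) with ha
  have ha1 : a ≤ 1 := Real.rpow_le_one_of_one_le_of_nonpos hk1 (by linarith)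
  have ha0 : 0 ≤ a := by positivity
  have ha2 : a ^ 2 = (k : ℝ) ^ (-(2 * r)) := by
    rw [ha, ← Real.rpow_natCast, ← Real.rpow_mul (by linarith)]
    congr 1
    push_cast
    ring
  set t : lp (fun _ : ℕ => ℝ) 2 := lp.single 2 k a with ht
  have htk : t k = a := lp.single_apply_self (E := fun _ : ℕ => ℝ) 2 k a
  have htj : ∀ j, j ≠ k → t j = 0 := fun j hj =>
    lp.single_apply_ne (E := fun _ : ℕ => ℝ) 2 k a hj
  have htn : ‖t‖ = a := by
    rw [ht, lp.norm_single (by norm_num), Real.norm_of_nonneg ha0]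
  have hPi : ∀ θ, P θ = Measure.infinitePi fun j =>
      gaussianReal (θ j) (Real.toNNReal (ε ^ 2 * sigmaSq j)) := fun θ =>
    (hP θ).unique (Measure.isProjectiveLimit_infinitePi _)
  have key := le_lintegral_infinitePi_gaussianReal_add
    (v := fun j => Real.toNNReal (ε ^ 2 * sigmaSq j)) (m := fun j => t j) (k := k)
    (s := √(ε ^ 2 * sigmaSq k)) (Real.sqrt_pos.2 (by linarith))
    (by rw [Real.sq_sqrt (by linarith)]) htj
    (by rw [htk]; exact ⟨ha0, ha1.trans (Real.one_le_sqrt.2 hv)⟩) hfhat t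
  have h0 : Measure.infinitePi (fun j => gaussianReal 0 (Real.toNNReal (ε ^ 2 * sigmaSq j))) =
      P 0 := by
    rw [hPi 0]; rfl
  rw [h0, ← hPi t, ← hκ, htn, ← ENNReal.ofReal_mul hκ0.le] at key
  have hsum : HasSum (fun j : ℕ => (j : ℝ) ^ (2 * r) * t j ^ 2) 1 := by
    have : (k : ℝ) ^ (2 * r) * t k ^ 2 = 1 := by
      rw [htk, ha2, ← Real.rpow_add (by linarith), add_neg_cancel, Real.rpow_zero]
    rw [← this]
    exact hasSum_single k fun j hj => by simp [htj j hj]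
  set S := ⨆ (θ : lp (fun _ : ℕ => ℝ) 2)
    (_ : Summable fun k : ℕ => (k : ℝ) ^ (2 * r) * θ k ^ 2)
    (_ : ∑' k : ℕ, (k : ℝ) ^ (2 * r) * θ k ^ 2 ≤ 1),
    ∫⁻ y, (‖fhat y - θ‖₊ : ℝ≥0∞) ^ 2 ∂(P θ)
  have hS : ∀ θ : lp (fun _ : ℕ => ℝ) 2,
      (Summable fun k : ℕ => (k : ℝ) ^ (2 * r) * θ k ^ 2) →
      ∑' k : ℕ, (k : ℝ) ^ (2 * r) * θ k ^ 2 ≤ 1 →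
      ∫⁻ y, (‖fhat y - θ‖₊ : ℝ≥0∞) ^ 2 ∂(P θ) ≤ S := fun θ h1 h2 =>
    le_iSup_of_le θ (le_iSup_of_le h1 (le_iSup_of_le h2 le_rfl))
  have hS0 := hS 0 (by simp) (by simp)
  have hSt := hS t hsum.summable hsum.tsum_eq.le
  simp only [sub_zero] at hS0
  have h2S : ENNReal.ofReal (κ * (a ^ 2 / 2)) ≤ 2 * S := by
    rw [two_mul]
    exact key.trans (add_le_add hS0 hSt)
  have h2 : (2 : ℝ≥0∞) = ENNReal.ofReal 2 := by simp
  refine (ENNReal.mul_le_mul_iff_right two_ne_zero ENNReal.ofNat_ne_top).1 (le_trans ?_ h2S)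
  rw [h2, ← ENNReal.ofReal_mul zero_le_two]
  apply ENNReal.ofReal_le_ofReal
  have hle : (9 : ℝ) ^ (-(2 * r)) * L ^ (-(2 * r)) ≤ a ^ 2 := by
    rw [← Real.mul_rpow (by norm_num) (by linarith), ha2]
    exact Real.rpow_le_rpow_of_nonpos (by linarith) hkU (by linarith)
  nlinarith [mul_le_mul_of_nonneg_left hle hκ0.le]
end
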